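/- Let m ≥ 1 and λ : ℤ →₀ ZMod m. Then h_alg(S_λ) = ∑_{p prime, p ∣ m} deg_p(λ)·k_p·log p, where k_p is the multiplicity of p in the prime factorization of m (so m = ∏_p p^{k_p}). -/

import Mathlib

/-- The one-dimensional finitary linear cellular automaton `S_lam` on `ZZ ->0 ZMod m`:
`(S_lam a) n = sum_i lam i * a (n + i)`. -/
noncomputable def SCA (m : ℕ) (lam : ℤ →₀ ZMod m) (a : ℤ →₀ ZMod m) : ℤ →₀ ZMod m :=
  lam.sum fun i c => c • Finsupp.equivMapDomain (Equiv.subRight i) a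

/-- `supp_p(lam) = {i : the image of lam i in ZMod p is nonzero}`. -/
noncomputable def suppP (m p : ℕ) (hd : p ∣ m) (lam : ℤ →₀ ZMod m) : Finset ℤ :=
  letI := Classical.decPred fun i : ℤ => ZMod.castHom hd (ZMod p) (lam i) ≠ 0
  lam.support.filter fun i => ZMod.castHom hd (ZMod p) (lam i) ≠ 0

/-- `deg_p(lam) = max(r,0) - min(l,0)` where `l = min supp_p(lam)`, `r = max supp_p(lam)`;
`deg_p(lam) = 0` if `supp_p(lam)` is empty. -/
noncomputable def degP (m p : ℕ) (hd : p ∣ m) (lam : ℤ →₀ ZMod m) : ℤ :=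
  if h : (suppP m p hd lam).Nonempty
  then max ((suppP m p hd lam).max' h) 0 - min ((suppP m p hd lam).min' h) 0
  else 0

open scoped Pointwise in
/-- The `n`-th trajectory of `F` under `phi`: `T_n(phi,F) = F + phi(F) + ... + phi^(n-1)(F)`
(with `T_0 = {0}`, the empty sum). -/
def Traj {G : Type*} [AddCommGroup G] (φ : G → G) (F : Set G) : ℕ → Set G
  | 0 => {0}
  | n + 1 => Traj φ F n + φ^[n] '' F

/-- The algebraic entropy of an endomorphism of an abelian group: the sup over
nonempty finite subsets `F` of `limsup (log |T_n(phi,F)|) / n`, in extended nonneg. reals. -/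
noncomputable def algEntropy {G : Type*} [AddCommGroup G] (φ : G → G) : ENNReal :=
  ⨆ (F : Set G) (_ : F.Finite) (_ : F.Nonempty),
    Filter.atTop.limsup fun n : ℕ =>
      ENNReal.ofReal (Real.log (Nat.card (Traj φ F n)) / n)

theorem SCA_apply (m : ℕ) (lam a : ℤ →₀ ZMod m) (x : ℤ) :
    SCA m lam a x = ∑ i ∈ lam.support, lam i * a (x + i) := by
  unfold SCA
  rw [Finsupp.sum, Finsupp.finsetSum_apply]
  refine Finset.sum_congr rfl fun i _ => ?_
  simp [Finsupp.equivMapDomain_apply]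

noncomputable def SCAHom (m : ℕ) (lam : ℤ →₀ ZMod m) : (ℤ →₀ ZMod m) →+ (ℤ →₀ ZMod m) where
  toFun := SCA m lam
  map_zero' := by ext x; simp [SCA_apply]
  map_add' a b := by ext x; simp [SCA_apply, mul_add, Finset.sum_add_distrib]

theorem castHom_zero_iff (m d : ℕ) [NeZero m] (hd : d ∣ m) (y : ZMod m) :
    ZMod.castHom hd (ZMod d) y = 0 ↔ (d : ZMod m) ∣ y := by
  constructor
  · intro h
    have h1 : y = ((y.val : ℕ) : ZMod m) := by simp
    rw [h1, map_natCast, ZMod.natCast_eq_zero_iff] at h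
    rw [h1]
    exact Nat.cast_dvd_cast h
  · rintro ⟨z, rfl⟩
    rw [map_mul, map_natCast, ZMod.natCast_self, zero_mul]

theorem crt_exists (m : ℕ) [NeZero m] :
    ∃ e : ZMod m ≃+* (∀ p : m.primeFactors, ZMod (p.1 ^ m.factorization p.1)),
      ∀ y p, e y p = 0 ↔ ((p.1 : ZMod m) ^ m.factorization p.1) ∣ y := by
  have hprod : m = ∏ p : m.primeFactors, p.1 ^ m.factorization p.1 := by
    conv_lhs => rw [← Nat.prod_factorization_pow_eq_self (NeZero.ne m)]
    rw [Finsupp.prod, Nat.support_factorization]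
    rw [← Finset.prod_attach]; rfl
  have hco : Pairwise fun i j : m.primeFactors =>
      Nat.Coprime (i.1 ^ m.factorization i.1) (j.1 ^ m.factorization j.1) := by
    intro i j hij
    apply Nat.Coprime.pow
    rw [Nat.coprime_primes (Nat.prime_of_mem_primeFactors i.2) (Nat.prime_of_mem_primeFactors j.2)]
    exact fun h => hij (Subtype.ext h)
  let e := (ZMod.ringEquivCongr hprod).trans
    (ZMod.prodEquivPi (fun p : m.primeFactors => p.1 ^ m.factorization p.1) hco)
  refine ⟨e, fun y p => ?_⟩
  have hd : p.1 ^ m.factorization p.1 ∣ m := Nat.ordProj_dvd m p.1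
  have h1 : (Pi.evalRingHom (fun p : m.primeFactors => ZMod (p.1 ^ m.factorization p.1)) p).comp
      (e : ZMod m →+* _) = ZMod.castHom hd (ZMod (p.1 ^ m.factorization p.1)) :=
    Subsingleton.elim _ _
  have h2 : e y p = ZMod.castHom hd (ZMod (p.1 ^ m.factorization p.1)) y := by rw [← h1]; rfl
  rw [h2, castHom_zero_iff]; push_cast; rfl

def BoxSet (m : ℕ) (B : m.primeFactors → Finset ℤ) : Set (ℤ →₀ ZMod m) :=
  {f | ∀ p, ∀ x, x ∉ B p → ((p.1 : ZMod m) ^ m.factorization p.1) ∣ f x}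

theorem boxSet_card (m : ℕ) [NeZero m] (B : m.primeFactors → Finset ℤ) :
    (BoxSet m B).Finite ∧
    Nat.card (BoxSet m B) = ∏ p, (p.1 ^ m.factorization p.1) ^ (B p).card := by
  classical
  obtain ⟨e, he⟩ := crt_exists m
  have hne : ∀ p : m.primeFactors, NeZero (p.1 ^ m.factorization p.1) := fun p =>
    ⟨pow_ne_zero _ (Nat.prime_of_mem_primeFactors p.2).ne_zero⟩
  let E : BoxSet m B ≃ (∀ p : m.primeFactors, B p → ZMod (p.1 ^ m.factorization p.1)) :=
    { toFun := fun f p x => e (f.1 x) p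
      invFun := fun c => ⟨Finsupp.onFinset (Finset.univ.biUnion B)
        (fun x => e.symm (fun p => if h : x ∈ B p then c p ⟨x, h⟩ else 0)) (by
          intro x hx
          by_contra hcon
          apply hx
          simp only [Finset.mem_biUnion, Finset.mem_univ, true_and, not_exists] at hcon
          have : (fun p => if h : x ∈ B p then c p ⟨x, h⟩ else 0) =
            (0 : ∀ p : m.primeFactors, ZMod (p.1 ^ m.factorization p.1)) := by
            funext p; simp [hcon p]
          rw [this, map_zero]), by
          intro p x hx
          rw [← he]
          simp [hx]⟩
      left_inv := by
        intro f
        apply Subtype.ext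
        ext x
        simp only [Finsupp.onFinset_apply]
        rw [RingEquiv.symm_apply_eq]
        funext p
        split_ifs with h
        · rfl
        · exact ((he _ p).2 (f.2 p x h)).symm
      right_inv := by
        intro c
        funext p x
        simp }
  constructor
  · exact Set.finite_coe_iff.mp (Finite.of_equiv _ E.symm)
  · rw [Nat.card_congr E, Nat.card_pi]
    refine Finset.prod_congr rfl fun p _ => ?_
    simp

theorem growth_step (m p : ℕ) (lam : ℤ →₀ ZMod m) (a b K C : ℤ)
    (hK0 : 0 ≤ K) (hK : ∀ i ∈ lam.support, |i| ≤ K) (ha : 0 ≤ a) (hb : b ≤ 0)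
    (hab : ∀ i, ¬ (p : ZMod m) ∣ lam i → b ≤ i ∧ i ≤ a) (f : ℤ →₀ ZMod m) (n : ℕ)
    (hf : ∀ (j : ℕ) (x : ℤ), (x < -C - a * n - j * K ∨ C - b * n + j * K < x) →
      (p : ZMod m) ^ j ∣ f x) :
    ∀ (j : ℕ) (x : ℤ), (x < -C - a * (n + 1 : ℕ) - j * K ∨ C - b * (n + 1 : ℕ) + j * K < x) →
      (p : ZMod m) ^ j ∣ SCA m lam f x := by
  intro j x hx
  rw [SCA_apply]
  refine Finset.dvd_sum fun i hi => ?_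
  push_cast at hx
  have hKi := abs_le.1 (hK i hi)
  by_cases hp : (p : ZMod m) ∣ lam i
  · cases j with
    | zero => simp
    | succ j =>
      rw [pow_succ, mul_comm]
      refine mul_dvd_mul hp (hf j _ ?_)
      push_cast at hx
      rcases hx with hx | hx
      · left; nlinarith
      · right; nlinarith
  · refine Dvd.dvd.mul_left (hf j _ ?_) _
    have := hab i hp
    rcases hx with hx | hx
    · left; nlinarith
    · right; nlinarith

theorem growth (m p : ℕ) (lam : ℤ →₀ ZMod m) (a b K C : ℤ)
    (hK0 : 0 ≤ K) (hK : ∀ i ∈ lam.support, |i| ≤ K) (ha : 0 ≤ a) (hb : b ≤ 0)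
    (hab : ∀ i, ¬ (p : ZMod m) ∣ lam i → b ≤ i ∧ i ≤ a) (f : ℤ →₀ ZMod m)
    (hf : ∀ x, (x < -C ∨ C < x) → f x = 0) (n : ℕ) :
    ∀ (j : ℕ) (x : ℤ), (x < -C - a * n - j * K ∨ C - b * n + j * K < x) →
      (p : ZMod m) ^ j ∣ ((SCA m lam)^[n] f) x := by
  induction n with
  | zero =>
    intro j x hx
    have : f x = 0 := by
      apply hf
      simp only [Nat.cast_zero, mul_zero, sub_zero] at hx
      have : (0:ℤ) ≤ j * K := by positivity
      rcases hx with hx | hx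
      · left; linarith
      · right; linarith
    simp [this]
  | succ n ih =>
    rw [Function.iterate_succ_apply']
    exact growth_step m p lam a b K C hK0 hK ha hb hab _ n ih

theorem traj_growth (m p : ℕ) (lam : ℤ →₀ ZMod m) (a b K C : ℤ)
    (hK0 : 0 ≤ K) (hK : ∀ i ∈ lam.support, |i| ≤ K) (ha : 0 ≤ a) (hb : b ≤ 0)
    (hab : ∀ i, ¬ (p : ZMod m) ∣ lam i → b ≤ i ∧ i ≤ a) (F : Set (ℤ →₀ ZMod m))
    (hF : ∀ f ∈ F, ∀ x, (x < -C ∨ C < x) → f x = 0) (n : ℕ) :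
    ∀ f ∈ Traj (SCA m lam) F n,
    ∀ (j : ℕ) (x : ℤ), (x < -C - a * n - j * K ∨ C - b * n + j * K < x) →
      (p : ZMod m) ^ j ∣ f x := by
  induction n with
  | zero =>
    intro f hf j x _
    have : f = 0 := hf
    simp [this]
  | succ n ih =>
    rintro f hf j x hx
    obtain ⟨g, hg, h, ⟨h', hh', rfl⟩, rfl⟩ := Set.mem_add.1 hf
    push_cast at hx
    have hx' : x < -C - a * n - j * K ∨ C - b * n + j * K < x := by
      rcases hx with hx | hx
      · left; linarith
      · right; linarith
    rw [Finsupp.add_apply]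
    exact dvd_add (ih g hg j x hx')
      (growth m p lam a b K C hK0 hK ha hb hab h' (hF h' hh') n j x hx')

theorem cop_dvd (m p t : ℕ) [NeZero m] (hp : p.Prime) (c y : ZMod m)
    (hc : ¬ (p : ZMod m) ∣ c) (h : (p : ZMod m) ^ t ∣ c * y) : (p : ZMod m) ^ t ∣ y := by
  have h1 : c = ((c.val : ℕ) : ZMod m) := by simp
  have h2 : ¬ p ∣ c.val := fun h => hc (by rw [h1]; exact Nat.cast_dvd_cast h)
  have h3 : Nat.Coprime (p ^ t) c.val := Nat.Coprime.pow_left _ ((hp.coprime_iff_not_dvd).2 h2)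
  have h4 := (Nat.isCoprime_iff_coprime.2 h3).map (Int.castRingHom (ZMod m))
  have h5 : IsCoprime ((p : ZMod m) ^ t) c := by
    rw [h1]; simpa using h4
  exact h5.dvd_of_dvd_mul_left h

theorem extreme (m p t : ℕ) [NeZero m] (hp : p.Prime) (lam : ℤ →₀ ZMod m) (r x0 : ℤ)
    (hr : ¬ (p : ZMod m) ∣ lam r) (f : ℤ →₀ ZMod m) (hf : ∀ x, (p : ZMod m) ^ t ∣ f x)
    (hx0 : ¬ (p : ZMod m) ^ (t + 1) ∣ f x0)
    (hlt : ∀ i, i ≠ r → ¬ (p : ZMod m) ∣ lam i → (p : ZMod m) ^ (t + 1) ∣ f (x0 - r + i)) :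
    ¬ (p : ZMod m) ^ (t + 1) ∣ SCA m lam f (x0 - r) := by
  intro h
  have hmem : r ∈ lam.support := by
    rw [Finsupp.mem_support_iff]; intro h0; apply hr; simp [h0]
  rw [SCA_apply, ← Finset.add_sum_erase _ _ hmem] at h
  have h2 : (p : ZMod m) ^ (t + 1) ∣ ∑ i ∈ lam.support.erase r, lam i * f (x0 - r + i) := by
    refine Finset.dvd_sum fun i hi => ?_
    by_cases hpi : (p : ZMod m) ∣ lam i
    · rw [pow_succ, mul_comm]; exact mul_dvd_mul hpi (hf _)
    · exact (hlt i (Finset.ne_of_mem_erase hi) hpi).mul_left _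
  have h3 := (dvd_add_left h2).1 h
  rw [sub_add_cancel] at h3
  exact hx0 (cop_dvd m p _ hp _ _ hr h3)

theorem SCA_dvd (m : ℕ) (q : ZMod m) (lam f : ℤ →₀ ZMod m) (hf : ∀ x, q ∣ f x) (x : ℤ) :
    q ∣ SCA m lam f x := by
  rw [SCA_apply]
  exact Finset.dvd_sum fun i _ => (hf _).mul_left _

theorem horner (m : ℕ) (lam : ℤ →₀ ZMod m) (d : ℕ → ℤ →₀ ZMod m) (n : ℕ) :
    ∑ i ∈ Finset.range (n + 1), (SCA m lam)^[i] (d i) =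
      d 0 + SCA m lam (∑ i ∈ Finset.range n, (SCA m lam)^[i] (d (i + 1))) := by
  rw [Finset.sum_range_succ', add_comm]
  congr 1
  change _ = SCAHom m lam _
  rw [map_sum]
  refine Finset.sum_congr rfl fun i _ => ?_
  rw [Function.iterate_succ_apply']; rfl

theorem sum_dvd (m : ℕ) (q : ZMod m) (lam : ℤ →₀ ZMod m) (n : ℕ) :
    ∀ (d : ℕ → ℤ →₀ ZMod m), (∀ i x, q ∣ d i x) →
    ∀ x, q ∣ (∑ i ∈ Finset.range n, (SCA m lam)^[i] (d i)) x := by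
  induction n with
  | zero => intro d _ x; simp
  | succ n ih =>
    intro d hd x
    rw [horner, Finsupp.add_apply]
    exact dvd_add (hd 0 x) (SCA_dvd _ _ _ _ (ih _ fun i => hd (i + 1)) x)

theorem indep (m p t : ℕ) [NeZero m] (hp : p.Prime) (lam : ℤ →₀ ZMod m) (l r D : ℤ)
    (hl : ¬ (p : ZMod m) ∣ lam l) (hr : ¬ (p : ZMod m) ∣ lam r)
    (hlr : ∀ i, ¬ (p : ZMod m) ∣ lam i → l ≤ i ∧ i ≤ r) (hD : D = max r 0 - min l 0) (n : ℕ) :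
    ∀ (d : ℕ → ℤ →₀ ZMod m), (∀ i x, (p : ZMod m) ^ t ∣ d i x) →
    (∀ i x, x ∉ Finset.Ico 0 D → (p : ZMod m) ^ (t + 1) ∣ d i x) →
    (∃ i < n, ∃ x, ¬ (p : ZMod m) ^ (t + 1) ∣ d i x) →
    ∃ x, ¬ (p : ZMod m) ^ (t + 1) ∣ (∑ i ∈ Finset.range n, (SCA m lam)^[i] (d i)) x ∧
      (0 < l → x < D) ∧ (r < 0 → 0 ≤ x) := by
  classical
  induction n with
  | zero => rintro d - - ⟨i, hi, -⟩; omega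
  | succ n ih =>
    intro d h1 h2 h3
    rw [horner]
    set g := ∑ i ∈ Finset.range n, (SCA m lam)^[i] (d (i + 1)) with hg
    have hgt : ∀ x, (p : ZMod m) ^ t ∣ g x := sum_dvd m _ lam n _ fun i => h1 (i + 1)
    by_cases h4 : ∃ i < n, ∃ x, ¬ (p : ZMod m) ^ (t + 1) ∣ d (i + 1) x
    · obtain ⟨x0, hx0, hx1, hx2⟩ := ih (fun i => d (i + 1)) (fun i => h1 (i + 1))
        (fun i => h2 (i + 1)) h4
      rw [← hg] at hx0
      let s := g.support.filter fun x => ¬ (p : ZMod m) ^ (t + 1) ∣ g x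
      have hs : ∀ x, x ∈ s ↔ ¬ (p : ZMod m) ^ (t + 1) ∣ g x := by
        intro x
        simp only [s, Finset.mem_filter, Finsupp.mem_support_iff, and_iff_right_iff_imp]
        intro h h0; apply h; simp [h0]
      have hne : s.Nonempty := ⟨x0, (hs _).2 hx0⟩
      have hlo0 := (hs _).1 (s.min'_mem hne)
      have hhi0 := (hs _).1 (s.max'_mem hne)
      have hlo1 : ∀ x, x < s.min' hne → (p : ZMod m) ^ (t + 1) ∣ g x := by
        intro x hx; by_contra hc
        exact absurd (s.min'_le x ((hs x).2 hc)) (not_le.2 hx)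
      have hhi1 : ∀ x, s.max' hne < x → (p : ZMod m) ^ (t + 1) ∣ g x := by
        intro x hx; by_contra hc
        exact absurd (s.le_max' x ((hs x).2 hc)) (not_le.2 hx)
      have hlox : s.min' hne ≤ x0 := s.min'_le x0 ((hs x0).2 hx0)
      have hhix : x0 ≤ s.max' hne := s.le_max' x0 ((hs x0).2 hx0)
      generalize s.min' hne = lo at *
      generalize s.max' hne = hi at *
      have key1 := extreme m p t hp lam r lo hr g hgt hlo0 (fun i hi hpi =>
        hlo1 _ (by have := hlr i hpi; omega))
      have key2 := extreme m p t hp lam l hi hl g hgt hhi0 (fun i hi hpi =>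
        hhi1 _ (by have := hlr i hpi; omega))
      have hllr := (hlr l hl).2
      have out : ∀ x, x ∉ Finset.Ico 0 D → ¬ (p : ZMod m) ^ (t + 1) ∣ SCA m lam g x →
          ¬ (p : ZMod m) ^ (t + 1) ∣ (d 0 + SCA m lam g) x := by
        intro x hx hn hc
        rw [Finsupp.add_apply] at hc
        exact hn ((dvd_add_right (h2 0 x hx)).1 hc)
      simp only [Finset.mem_Ico] at out
      by_cases c1 : 0 < l
      · have := hx1 c1
        exact ⟨lo - r, out _ (by omega) key1, fun _ => by omega, fun _ => by omega⟩
      · by_cases c2 : r < 0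
        · have := hx2 c2
          exact ⟨hi - l, out _ (by omega) key2, fun _ => by omega, fun _ => by omega⟩
        · by_cases c3 : 0 ≤ lo - r ∧ lo - r < D
          · exact ⟨hi - l, out _ (by omega) key2, fun _ => by omega, fun _ => by omega⟩
          · exact ⟨lo - r, out _ c3 key1, fun _ => by omega, fun _ => by omega⟩
    · have h5 : ∀ x, (p : ZMod m) ^ (t + 1) ∣ g x := by
        have : g = ∑ i ∈ Finset.range n, (SCA m lam)^[i] ((fun i => if i < n then d (i + 1) else 0) i) := by
          rw [hg]
          refine Finset.sum_congr rfl fun i hi => ?_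
          simp [Finset.mem_range.1 hi]
        rw [this]
        refine sum_dvd m _ lam n _ fun i x => ?_
        by_cases hi : i < n
        · simp only [hi, if_true]
          by_contra hc; exact h4 ⟨i, hi, x, hc⟩
        · simp [hi]
      obtain ⟨i, hi, x, hx⟩ := h3
      cases i with
      | succ i => exact absurd ⟨i, by omega, x, hx⟩ h4
      | zero =>
        have hxI : x ∈ Finset.Ico 0 D := by by_contra hc; exact hx (h2 0 x hc)
        rw [Finset.mem_Ico] at hxI
        refine ⟨x, ?_, fun _ => hxI.2, fun _ => hxI.1⟩
        rw [Finsupp.add_apply]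
        intro hc
        exact hx ((dvd_add_left (SCA_dvd _ _ _ _ h5 x)).1 hc)

theorem mem_suppP (m p : ℕ) [NeZero m] (hd : p ∣ m) (lam : ℤ →₀ ZMod m) (i : ℤ) :
    i ∈ suppP m p hd lam ↔ ¬ (p : ZMod m) ∣ lam i := by
  unfold suppP
  rw [← castHom_zero_iff m p hd]
  simp only [Finset.mem_filter, Finsupp.mem_support_iff]
  constructor
  · exact fun h => h.2
  · intro h
    refine ⟨fun h0 => h ?_, h⟩
    rw [h0, map_zero]

theorem degP_spec (m p : ℕ) [NeZero m] (hd : p ∣ m) (lam : ℤ →₀ ZMod m) :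
    (∃ a b : ℤ, 0 ≤ a ∧ b ≤ 0 ∧ degP m p hd lam = a - b ∧
      ∀ i, ¬ (p : ZMod m) ∣ lam i → b ≤ i ∧ i ≤ a) ∧
    (degP m p hd lam = 0 ∨ ∃ l r : ℤ, ¬ (p : ZMod m) ∣ lam l ∧ ¬ (p : ZMod m) ∣ lam r ∧
      (∀ i, ¬ (p : ZMod m) ∣ lam i → l ≤ i ∧ i ≤ r) ∧
      degP m p hd lam = max r 0 - min l 0) := by
  by_cases h : (suppP m p hd lam).Nonempty
  · have h1 : degP m p hd lam = max ((suppP m p hd lam).max' h) 0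
        - min ((suppP m p hd lam).min' h) 0 := by simp [degP, h]
    have hb : ∀ i, ¬ (p : ZMod m) ∣ lam i → (suppP m p hd lam).min' h ≤ i ∧
        i ≤ (suppP m p hd lam).max' h := fun i hi =>
      ⟨Finset.min'_le _ _ ((mem_suppP m p hd lam i).2 hi),
        Finset.le_max' _ _ ((mem_suppP m p hd lam i).2 hi)⟩
    refine ⟨⟨_, _, le_max_right _ _, min_le_right _ _, h1, fun i hi => ?_⟩, Or.inr ⟨_, _,
      (mem_suppP m p hd lam _).1 (Finset.min'_mem _ h),
      (mem_suppP m p hd lam _).1 (Finset.max'_mem _ h), hb, h1⟩⟩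
    exact ⟨(min_le_left _ _).trans (hb i hi).1, (hb i hi).2.trans (le_max_left _ _)⟩
  · have h1 : degP m p hd lam = 0 := by simp [degP, h]
    refine ⟨⟨0, 0, le_rfl, le_rfl, by simp [h1], fun i hi => ?_⟩, Or.inl h1⟩
    exact absurd ⟨i, (mem_suppP m p hd lam i).2 hi⟩ h

theorem indep_final (m p k : ℕ) [NeZero m] (hp : p.Prime) (hd : p ∣ m) (lam : ℤ →₀ ZMod m)
    (n : ℕ) (d : ℕ → ℤ →₀ ZMod m) (hdn : ∀ i, n ≤ i → d i = 0)
    (hbox : ∀ i x, x ∉ Finset.Ico 0 (degP m p hd lam) → (p : ZMod m) ^ k ∣ d i x)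
    (hsum : ∑ i ∈ Finset.range n, (SCA m lam)^[i] (d i) = 0) :
    ∀ i x, (p : ZMod m) ^ k ∣ d i x := by
  rcases (degP_spec m p hd lam).2 with h0 | ⟨l, r, hl, hr, hlr, hD⟩
  · intro i x
    exact hbox i x (by simp [h0])
  · suffices ∀ t ≤ k, ∀ i x, (p : ZMod m) ^ t ∣ d i x from this k le_rfl
    intro t
    induction t with
    | zero => intro _ i x; simp
    | succ t ih =>
      intro htk i x
      by_contra hc
      have hin : i < n := by
        by_contra hin; apply hc; simp [hdn i (not_lt.1 hin)]
      obtain ⟨y, hy, -⟩ := indep m p t hp lam l r _ hl hr hlr hD n d (ih (by omega))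
        (fun i x hx => (pow_dvd_pow _ htk).trans (hbox i x hx)) ⟨i, hin, x, hc⟩
      apply hy
      simp [hsum]

theorem mem_traj (m : ℕ) (lam : ℤ →₀ ZMod m) (F : Set (ℤ →₀ ZMod m)) (d : ℕ → ℤ →₀ ZMod m)
    (n : ℕ) (hd : ∀ i < n, d i ∈ F) :
    ∑ i ∈ Finset.range n, (SCA m lam)^[i] (d i) ∈ Traj (SCA m lam) F n := by
  induction n with
  | zero => simp [Traj]
  | succ n ih =>
    rw [Finset.sum_range_succ]
    exact Set.add_mem_add (ih fun i hi => hd i (by omega)) ⟨_, hd n (by omega), rfl⟩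

theorem traj_finite (m : ℕ) (lam : ℤ →₀ ZMod m) (F : Set (ℤ →₀ ZMod m)) (hF : F.Finite) (n : ℕ) :
    (Traj (SCA m lam) F n).Finite := by
  induction n with
  | zero => exact Set.finite_singleton _
  | succ n ih => exact ih.add (hF.image _)

noncomputable def lowF (m : ℕ) (lam : ℤ →₀ ZMod m) : Set (ℤ →₀ ZMod m) :=
  BoxSet m fun p => Finset.Ico 0 (degP m p.1 (Nat.dvd_of_mem_primeFactors p.2) lam)

theorem eq_zero_of_dvd (m : ℕ) [NeZero m] (y : ZMod m)
    (h : ∀ p : m.primeFactors, ((p.1 : ZMod m) ^ m.factorization p.1) ∣ y) : y = 0 := by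
  obtain ⟨e, he⟩ := crt_exists m
  apply e.injective
  rw [map_zero]
  funext p
  exact (he y p).2 (h p)

theorem iter_sub (m : ℕ) (lam : ℤ →₀ ZMod m) (n : ℕ) (x y : ℤ →₀ ZMod m) :
    (SCA m lam)^[n] (x - y) = (SCA m lam)^[n] x - (SCA m lam)^[n] y := by
  induction n with
  | zero => rfl
  | succ n ih =>
    simp only [Function.iterate_succ_apply', ih]
    exact map_sub (SCAHom m lam) _ _

theorem lower_card (m : ℕ) [NeZero m] (lam : ℤ →₀ ZMod m) (n : ℕ) :
    (Nat.card (lowF m lam)) ^ n ≤ Nat.card (Traj (SCA m lam) (lowF m lam) n) := by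
  classical
  have hfin : (lowF m lam).Finite := (boxSet_card m _).1
  have : Finite (lowF m lam) := hfin
  have : Finite (Traj (SCA m lam) (lowF m lam) n) := traj_finite m lam _ hfin n
  let ext : (Fin n → lowF m lam) → ℕ → ℤ →₀ ZMod m :=
    fun c i => if h : i < n then (c ⟨i, h⟩).1 else 0
  let Φ : (Fin n → lowF m lam) → Traj (SCA m lam) (lowF m lam) n := fun c =>
    ⟨∑ i ∈ Finset.range n, (SCA m lam)^[i] (ext c i), mem_traj m lam _ _ n fun i hi => by
      simp only [ext, hi, dif_pos]; exact (c ⟨i, hi⟩).2⟩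
  have hΦ : Function.Injective Φ := by
    intro c c' h
    have h1 : ∑ i ∈ Finset.range n, (SCA m lam)^[i] (ext c i) =
      ∑ i ∈ Finset.range n, (SCA m lam)^[i] (ext c' i) := congrArg Subtype.val h
    have hz : ∀ i x, (ext c i - ext c' i) x = 0 := by
      intro i x
      apply eq_zero_of_dvd
      intro p
      refine indep_final m p.1 _ (Nat.prime_of_mem_primeFactors p.2)
        (Nat.dvd_of_mem_primeFactors p.2) lam n (fun i => ext c i - ext c' i) ?_ ?_ ?_ i x
      · intro i hi
        simp [ext, not_lt.2 hi]
      · intro i x hx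
        by_cases hi : i < n
        · simp only [ext, hi, dif_pos, Finsupp.sub_apply]
          exact dvd_sub ((c ⟨i, hi⟩).2 p x hx) ((c' ⟨i, hi⟩).2 p x hx)
        · simp [ext, hi]
      · simp only [iter_sub, Finset.sum_sub_distrib, h1, sub_self]
    funext i
    apply Subtype.ext
    ext x
    have := hz i.1 x
    simp only [ext, i.2, dif_pos, Finsupp.sub_apply, sub_eq_zero] at this
    rw [this]
  have := Nat.card_le_card_of_injective Φ hΦ
  rw [Nat.card_fun, Nat.card_fin] at this
  exact this

theorem log_prod (m : ℕ) (N : m.primeFactors → ℕ) :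
    Real.log ((∏ p, (p.1 ^ m.factorization p.1) ^ (N p) : ℕ) : ℝ) =
      ∑ p : m.primeFactors, (N p : ℝ) * ((m.factorization p.1 : ℝ) * Real.log p.1) := by
  push_cast
  rw [Real.log_prod]
  · refine Finset.sum_congr rfl fun p _ => ?_
    rw [Real.log_pow, Real.log_pow]
  · intro p _
    have := (Nat.prime_of_mem_primeFactors p.2).ne_zero
    positivity

theorem upper_card (m : ℕ) [NeZero m] (lam : ℤ →₀ ZMod m) (F : Set (ℤ →₀ ZMod m))
    (hF : F.Finite) : ∃ c : m.primeFactors → ℕ, ∀ n : ℕ,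
    Nat.card (Traj (SCA m lam) F n) ≤ ∏ p : m.primeFactors, (p.1 ^ m.factorization p.1) ^
      ((degP m p.1 (Nat.dvd_of_mem_primeFactors p.2) lam).toNat * n + c p) := by
  classical
  obtain ⟨C, hC0, hC⟩ : ∃ C : ℤ, 0 ≤ C ∧ ∀ f ∈ F, ∀ x, (x < -C ∨ C < x) → f x = 0 := by
    refine ⟨∑ f ∈ hF.toFinset, ∑ x ∈ f.support, |x|, by positivity, ?_⟩
    intro f hf x hx
    by_contra hne
    have h1 : |x| ≤ ∑ x ∈ f.support, |x| :=
      Finset.single_le_sum (f := fun x : ℤ => |x|) (fun i _ => abs_nonneg i) (Finsupp.mem_support_iff.2 hne)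
    have h2 : ∑ x ∈ f.support, |x| ≤ ∑ f ∈ hF.toFinset, ∑ x ∈ f.support, |x| :=
      Finset.single_le_sum (f := fun f : ℤ →₀ ZMod m => ∑ x ∈ f.support, |x|)
        (fun i _ => Finset.sum_nonneg fun _ _ => abs_nonneg _) (hF.mem_toFinset.2 hf)
    have := abs_le.1 (h1.trans h2)
    rcases hx with hx | hx
    · exact absurd this.1 (not_le.2 hx)
    · exact absurd this.2 (not_le.2 hx)
  obtain ⟨K, hK0, hK⟩ : ∃ K : ℤ, 0 ≤ K ∧ ∀ i ∈ lam.support, |i| ≤ K :=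
    ⟨∑ i ∈ lam.support, |i|, by positivity, fun i hi =>
      Finset.single_le_sum (f := fun x : ℤ => |x|) (fun i _ => abs_nonneg i) hi⟩
  have hspec := fun p : m.primeFactors =>
    (degP_spec m p.1 (Nat.dvd_of_mem_primeFactors p.2) lam).1
  choose a b ha hb hab hin using hspec
  refine ⟨fun p => (2 * C + 2 * (m.factorization p.1) * K + 1).toNat, fun n => ?_⟩
  let B : m.primeFactors → Finset ℤ := fun p =>
    Finset.Icc (-C - a p * n - (m.factorization p.1) * K) (C - b p * n + (m.factorization p.1) * K)
  have hsub : Traj (SCA m lam) F n ⊆ BoxSet m B := by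
    intro f hf p x hx
    refine traj_growth m p.1 lam (a p) (b p) K C hK0 hK (ha p) (hb p) (hin p) F hC n f hf _ x ?_
    simp only [B, Finset.mem_Icc, not_and_or, not_le] at hx
    exact hx
  refine (Nat.card_mono (boxSet_card m B).1 hsub).trans ?_
  rw [(boxSet_card m B).2]
  refine Finset.prod_le_prod' fun p _ => ?_
  refine Nat.pow_le_pow_right (pow_pos (Nat.prime_of_mem_primeFactors p.2).pos _) ?_
  simp only [B, Int.card_Icc]
  rw [hab p]
  have e1 : 0 ≤ a p - b p := by have := ha p; have := hb p; omega
  have e2 : (0:ℤ) ≤ 2 * C + 2 * (m.factorization p.1) * K + 1 := by positivity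
  zify
  rw [Int.toNat_of_nonneg e1, Int.toNat_of_nonneg e2]
  rw [Int.ofNat_toNat]
  apply max_le
  · apply le_of_eq; ring
  · positivity

theorem stmt16 (m : ℕ) (hm : 1 ≤ m) (lam : ℤ →₀ ZMod m) :
    algEntropy (SCA m lam)
      = ENNReal.ofReal
          (∑ p ∈ m.primeFactors.attach,
            (degP m p.1 (Nat.dvd_of_mem_primeFactors p.2) lam : ℝ)
              * ((m.factorization p.1 : ℝ) * Real.log p.1)) := by
  have : NeZero m := ⟨by omega⟩
  have hnn : ∀ p : m.primeFactors,
      0 ≤ degP m p.1 (Nat.dvd_of_mem_primeFactors p.2) lam := by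
    intro p
    obtain ⟨⟨a, b, ha, hb, h, -⟩, -⟩ := degP_spec m p.1 (Nat.dvd_of_mem_primeFactors p.2) lam
    omega
  rw [← Finset.univ_eq_attach]
  set h : ℝ := ∑ p : m.primeFactors, (degP m p.1 (Nat.dvd_of_mem_primeFactors p.2) lam : ℝ)
              * ((m.factorization p.1 : ℝ) * Real.log p.1) with hh
  have hcast : ∀ p : m.primeFactors,
      ((degP m p.1 (Nat.dvd_of_mem_primeFactors p.2) lam).toNat : ℝ) =
        (degP m p.1 (Nat.dvd_of_mem_primeFactors p.2) lam : ℝ) := by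
    intro p
    exact_mod_cast congrArg (Int.cast : ℤ → ℝ) (Int.toNat_of_nonneg (hnn p))
  apply le_antisymm
  · refine iSup_le fun F => iSup_le fun hF => iSup_le fun hne => ?_
    obtain ⟨c, hc⟩ := upper_card m lam F hF
    set c' : ℝ := ∑ p : m.primeFactors, (c p : ℝ) * ((m.factorization p.1 : ℝ) * Real.log p.1)
    have htend : Filter.Tendsto (fun n : ℕ => ENNReal.ofReal (h + c' / n)) Filter.atTop
        (nhds (ENNReal.ofReal h)) := by
      apply ENNReal.tendsto_ofReal
      simpa using (tendsto_const_nhds (x := h)).add (tendsto_const_div_atTop_nhds_zero_nat c')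
    rw [← htend.limsup_eq]
    refine Filter.limsup_le_limsup ?_
    · filter_upwards [Filter.eventually_gt_atTop 0] with n hn
      apply ENNReal.ofReal_le_ofReal
      have hn' : (0 : ℝ) < n := by exact_mod_cast hn
      rw [div_le_iff₀ hn']
      have e : (h + c' / n) * n = h * n + c' := by field_simp
      rw [e]
      have hle : Real.log (Nat.card (Traj (SCA m lam) F n)) ≤ Real.log ((∏ p : m.primeFactors,
          (p.1 ^ m.factorization p.1) ^ ((degP m p.1 (Nat.dvd_of_mem_primeFactors p.2) lam).toNat
            * n + c p) : ℕ) : ℝ) := by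
        rcases Nat.eq_zero_or_pos (Nat.card (Traj (SCA m lam) F n)) with h0 | h0
        · rw [h0]; simp only [Nat.cast_zero, Real.log_zero]
          exact Real.log_natCast_nonneg _
        · exact Real.log_le_log (by exact_mod_cast h0) (by exact_mod_cast hc n)
      refine hle.trans (le_of_eq ?_)
      rw [log_prod, hh, Finset.sum_mul, ← Finset.sum_add_distrib]
      refine Finset.sum_congr rfl fun p _ => ?_
      push_cast
      rw [hcast p]
      ring
  · have hfin : (lowF m lam).Finite := (boxSet_card m _).1
    have hne : (lowF m lam).Nonempty := ⟨0, fun p x _ => by simp⟩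
    refine le_iSup_of_le (lowF m lam) (le_iSup_of_le hfin (le_iSup_of_le hne ?_))
    apply Filter.le_limsup_of_frequently_le'
    apply Filter.Eventually.frequently
    filter_upwards [Filter.eventually_gt_atTop 0] with n hn
    apply ENNReal.ofReal_le_ofReal
    have hn' : (0 : ℝ) < n := by exact_mod_cast hn
    rw [le_div_iff₀ hn']
    have hlog : h = Real.log (Nat.card (lowF m lam)) := by
      unfold lowF
      rw [(boxSet_card m _).2, log_prod, hh]
      refine Finset.sum_congr rfl fun p _ => ?_
      rw [Int.card_Ico, sub_zero, hcast p]
    have hpos : 0 < Nat.card (lowF m lam) := by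
      have : Finite (lowF m lam) := hfin
      have : Nonempty (lowF m lam) := hne.to_subtype
      exact Nat.card_pos
    rw [hlog, mul_comm, ← Real.log_pow]
    apply Real.log_le_log
    · positivity
    · exact_mod_cast lower_card m lam n
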